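/- arXiv:1904.03984 — 4 statements merged into one kernel-verified Lean document; each statement's English description precedes it below -/
import Mathlib

section
/- Let ω₁, …, ω_l be concave moduli of continuity and let g₁, …, g_l be orientation-preserving circle diffeomorphisms such that g_k is of class C^{1+ω_k}; let C_k be the ω_k-constant of log∘Dg_k and C = max{C₁,…,C_l}. Fix n₀ ∈ ℕ, indices k₁,…,k_{n₀} ∈ {1,…,l}, an interval I ⊂ S¹, and a constant S > 0 such that Σ_{n=0}^{n₀−1} ω_{k_{n+1}}(|g_{k_n}∘⋯∘g_{k_1}(I)|) ≤ S. Set L := |I|/(2·exp(2CS)). If there exists n ≤ n₀ such that the interval g_{k_n}∘⋯∘g_{k_1}(I) is contained in the L-neighborhood of I but does not intersect I, then the map g_{k_n}∘⋯∘g_{k_1} has a fixed point. -/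
open Filter Set

/-- A modulus of continuity: a continuous, strictly increasing function on `[0,1]`
with value `0` at `0` (hence nonnegative). -/
def IsModulus (ω : ℝ → ℝ) : Prop :=
  ContinuousOn ω (Icc 0 1) ∧ StrictMonoOn ω (Icc 0 1) ∧ ω 0 = 0 ∧
    ∀ t ∈ Icc (0 : ℝ) 1, 0 ≤ ω t

/-- A concave modulus of continuity. -/
def IsConcaveModulus (ω : ℝ → ℝ) : Prop :=
  IsModulus ω ∧ ConcaveOn ℝ (Icc 0 1) ω

/-- `f : ℝ → ℝ` is the lift of an orientation-preserving `C¹` circle diffeomorphism. -/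
def IsCircleDiffeoLift (f : ℝ → ℝ) : Prop :=
  StrictMono f ∧ (∀ x, f (x + 1) = f x + 1) ∧ ContDiff ℝ 1 f ∧ ∀ x, 0 < deriv f x

/-- `compSeq g n = g (n-1) ∘ ⋯ ∘ g 0` (the empty composition being the identity). -/
def compSeq (g : ℕ → ℝ → ℝ) : ℕ → ℝ → ℝ
  | 0 => id
  | n + 1 => g n ∘ compSeq g n

theorem IsConcaveModulus.two_mul_le {ω : ℝ → ℝ} (hω : IsConcaveModulus ω) {t : ℝ}
    (ht : 0 ≤ t) (ht' : 2 * t ≤ 1) : ω (2 * t) ≤ 2 * ω t := by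
  have h := hω.2.2 ⟨le_rfl, zero_le_one⟩ (⟨by linarith, ht'⟩ : 2 * t ∈ Icc (0 : ℝ) 1)
    (by norm_num : (0 : ℝ) ≤ 1 / 2) (by norm_num : (0 : ℝ) ≤ 1 / 2) (by norm_num)
  simp only [smul_eq_mul, hω.1.2.2.1] at h
  rw [show (1 / 2 * 0 + 1 / 2 * (2 * t) : ℝ) = t by ring] at h
  linarith

/-- A `1`-periodic function that is `ω`-continuous with constant `C` oscillates by at most
`2 C ω(t)` at scale `2t`, even when `2t > 1`. -/
theorem IsConcaveModulus.abs_sub_le_of_periodic {ω φ : ℝ → ℝ} (hω : IsConcaveModulus ω)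
    (hφ : Function.Periodic φ 1) {C : ℝ} (hC : 0 ≤ C)
    (h : ∀ x y, |x - y| ≤ 1 → |φ x - φ y| ≤ C * ω |x - y|)
    {t : ℝ} (ht : t ∈ Icc (0 : ℝ) 1) {x y : ℝ} (hxy : |x - y| ≤ 2 * t) :
    |φ x - φ y| ≤ C * (2 * ω t) := by
  have hmono := hω.1.2.1.monotoneOn
  rcases le_total (2 * t) 1 with h2 | h2
  · refine (h x y (hxy.trans h2)).trans (mul_le_mul_of_nonneg_left ?_ hC)
    exact (hmono ⟨abs_nonneg _, hxy.trans h2⟩ ⟨by linarith [ht.1], h2⟩ hxy).trans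
      (hω.two_mul_le ht.1 h2)
  · have hr : |x - (y + round (x - y))| ≤ 1 / 2 := by
      simpa [sub_sub] using abs_sub_round (x - y)
    have hy : φ (y + round (x - y)) = φ y := by
      simpa using hφ.int_mul (round (x - y)) y
    have h1 := h x (y + round (x - y)) (by linarith)
    rw [hy] at h1
    refine h1.trans (mul_le_mul_of_nonneg_left ?_ hC)
    have := hmono ⟨abs_nonneg _, by linarith⟩ ht (hr.trans (by linarith : (1 / 2 : ℝ) ≤ t))
    linarith [hω.1.2.2.2 t ht]

theorem IsCircleDiffeoLift.id : IsCircleDiffeoLift id :=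
  ⟨strictMono_id, fun _ => rfl, contDiff_id, fun x => by simp⟩

theorem IsCircleDiffeoLift.differentiable {f : ℝ → ℝ} (hf : IsCircleDiffeoLift f) :
    Differentiable ℝ f :=
  hf.2.2.1.differentiable one_ne_zero

theorem IsCircleDiffeoLift.deriv_comp {f g : ℝ → ℝ} (hf : IsCircleDiffeoLift f)
    (hg : IsCircleDiffeoLift g) (x : ℝ) : deriv (f ∘ g) x = deriv f (g x) * deriv g x :=
  _root_.deriv_comp x (hf.differentiable _) (hg.differentiable _)

theorem IsCircleDiffeoLift.comp {f g : ℝ → ℝ} (hf : IsCircleDiffeoLift f)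
    (hg : IsCircleDiffeoLift g) : IsCircleDiffeoLift (f ∘ g) := by
  refine ⟨hf.1.comp hg.1, fun x => by simp [hg.2.1, hf.2.1], hf.2.2.1.comp hg.2.2.1, fun x => ?_⟩
  rw [hf.deriv_comp hg]
  exact mul_pos (hf.2.2.2 _) (hg.2.2.2 _)

theorem IsCircleDiffeoLift.periodic_log_deriv {f : ℝ → ℝ} (hf : IsCircleDiffeoLift f) :
    Function.Periodic (fun x => Real.log (deriv f x)) 1 := by
  intro x
  have h : (fun y => f (y + 1)) = fun y => f y + 1 := funext hf.2.1
  have h' := congrArg (fun F => deriv F x) h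
  simp only [deriv_comp_add_const, deriv_add_const] at h'
  simp only [h']

theorem IsCircleDiffeoLift.sub_mem_Icc {f : ℝ → ℝ} (hf : IsCircleDiffeoLift f) {a b : ℝ}
    (hab : a ≤ b) (hlen : b - a ≤ 1) : f b - f a ∈ Icc (0 : ℝ) 1 := by
  have h1 := hf.1.monotone hab
  have h2 := hf.1.monotone (by linarith : b ≤ a + 1)
  rw [hf.2.1] at h2
  exact ⟨by linarith, by linarith⟩

theorem isCircleDiffeoLift_compSeq {g : ℕ → ℝ → ℝ} (hg : ∀ i, IsCircleDiffeoLift (g i)) (n : ℕ) :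
    IsCircleDiffeoLift (compSeq g n) := by
  induction n with
  | zero => exact .id
  | succ n ih => exact (hg n).comp ih

theorem abs_log_deriv_compSeq_sub_le {g : ℕ → ℝ → ℝ} (hg : ∀ i, IsCircleDiffeoLift (g i))
    (n : ℕ) (x y : ℝ) :
    |Real.log (deriv (compSeq g n) x) - Real.log (deriv (compSeq g n) y)| ≤
      ∑ i ∈ Finset.range n, |Real.log (deriv (g i) (compSeq g i x)) -
        Real.log (deriv (g i) (compSeq g i y))| := by
  induction n with
  | zero => simp [compSeq]
  | succ n ih =>
    have hF := isCircleDiffeoLift_compSeq hg n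
    have key (z : ℝ) : Real.log (deriv (compSeq g (n + 1)) z) =
        Real.log (deriv (g n) (compSeq g n z)) + Real.log (deriv (compSeq g n) z) := by
      rw [compSeq, (hg n).deriv_comp hF, Real.log_mul ((hg n).2.2.2 _).ne' (hF.2.2.2 _).ne']
    rw [Finset.sum_range_succ, key, key, add_sub_add_comm, add_comm]
    exact (abs_add_le _ _).trans (add_le_add ih le_rfl)

/-- If the distortion of `f` on `[u, v]` is at most `D`, the complement of `[a, b]` in `[u, v]`
is stretched at most `exp D` times more than `[a, b]`. -/
theorem IsCircleDiffeoLift.excess_le {f : ℝ → ℝ} (hf : IsCircleDiffeoLift f) {a b u v D : ℝ}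
    (hab : a < b) (hu : u ≤ a) (hv : b ≤ v) (hD : v - u - (b - a) ≤ (b - a) / Real.exp D)
    (hdist : ∀ x ∈ Icc u v, ∀ y ∈ Icc u v,
      |Real.log (deriv f x) - Real.log (deriv f y)| ≤ D) :
    f v - f u ≤ 2 * (f b - f a) := by
  obtain ⟨c, hc, hc'⟩ := exists_deriv_eq_slope f hab hf.differentiable.continuous.continuousOn
    hf.differentiable.differentiableOn
  have hcuv : c ∈ Icc u v := ⟨hu.trans hc.1.le, hc.2.le.trans hv⟩
  have hder : ∀ x ∈ Icc u v, deriv f x ≤ Real.exp D * deriv f c := by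
    intro x hx
    have h := (abs_le.1 (hdist x hx c hcuv)).2
    rw [← Real.log_le_log_iff (hf.2.2.2 x) (mul_pos (Real.exp_pos _) (hf.2.2.2 c)),
      Real.log_mul (Real.exp_pos _).ne' (hf.2.2.2 c).ne', Real.log_exp]
    linarith
  have hmvt : ∀ x ∈ Icc u v, ∀ y ∈ Icc u v, x ≤ y →
      f y - f x ≤ Real.exp D * deriv f c * (y - x) :=
    (convex_Icc u v).image_sub_le_mul_sub_of_deriv_le hf.differentiable.continuous.continuousOn
      hf.differentiable.differentiableOn fun x hx => hder x (interior_subset hx)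
  have h1 := hmvt u ⟨le_rfl, by linarith⟩ a ⟨hu, by linarith⟩ hu
  have h2 := hmvt b ⟨by linarith, hv⟩ v ⟨by linarith, le_rfl⟩ hv
  have hpos : 0 < b - a := sub_pos.2 hab
  have hM : 0 ≤ Real.exp D * deriv f c := (mul_pos (Real.exp_pos _) (hf.2.2.2 c)).le
  have h3 := mul_le_mul_of_nonneg_left hD hM
  have h4 : Real.exp D * deriv f c * ((b - a) / Real.exp D) = f b - f a := by
    rw [hc']
    field_simp
  linarith

theorem compSeq_sub_le_two_mul {g ω : ℕ → ℝ → ℝ} (hω : ∀ i, IsConcaveModulus (ω i))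
    (hg : ∀ i, IsCircleDiffeoLift (g i)) {C : ℝ} (hC : 0 ≤ C)
    (hconst : ∀ (i : ℕ) (x y : ℝ), |x - y| ≤ 1 →
      |Real.log (deriv (g i) x) - Real.log (deriv (g i) y)| ≤ C * ω i |x - y|)
    {n₀ : ℕ} {a b S : ℝ} (hab : a < b) (hlen : b - a ≤ 1)
    (hsum : ∑ n ∈ Finset.range n₀, ω n (compSeq g n b - compSeq g n a) ≤ S)
    {u v : ℝ} (hu : u ≤ a) (hv : b ≤ v)
    (huv : v - u - (b - a) ≤ (b - a) / Real.exp (2 * C * S)) {n : ℕ} (hn : n ≤ n₀) :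
    compSeq g n v - compSeq g n u ≤ 2 * (compSeq g n b - compSeq g n a) := by
  induction n using Nat.strong_induction_on with
  | _ n ih =>
    refine (isCircleDiffeoLift_compSeq hg n).excess_le hab hu hv huv fun x hx y hy => ?_
    have hmem (i : ℕ) := (isCircleDiffeoLift_compSeq hg i).sub_mem_Icc hab.le hlen
    calc _ ≤ _ := abs_log_deriv_compSeq_sub_le hg n x y
      _ ≤ ∑ i ∈ Finset.range n, C * (2 * ω i (compSeq g i b - compSeq g i a)) := by
        refine Finset.sum_le_sum fun i hi => ?_
        have hin := Finset.mem_range.1 hi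
        have hF := (isCircleDiffeoLift_compSeq hg i).1.monotone
        refine (hω i).abs_sub_le_of_periodic (hg i).periodic_log_deriv hC (hconst i) (hmem i) ?_
        refine le_trans ?_ (ih i hin (hin.le.trans hn))
        exact abs_sub_le_of_le_of_le (hF hx.1) (hF hx.2) (hF hy.1) (hF hy.2)
      _ = 2 * C * ∑ i ∈ Finset.range n, ω i (compSeq g i b - compSeq g i a) := by
        rw [Finset.mul_sum]
        exact Finset.sum_congr rfl fun i _ => by ring
      _ ≤ 2 * C * S := by
        refine mul_le_mul_of_nonneg_left (le_trans ?_ hsum) (by positivity)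
        exact Finset.sum_le_sum_of_subset_of_nonneg (Finset.range_mono hn)
          fun i _ _ => (hω i).1.2.2.2 _ (hmem i)

/-- Lemma (fixed point): with the distortion sum bounded by `S` and
`L = |I| / (2 exp(2CS))`, if some composition `g_{k_n} ∘ ⋯ ∘ g_{k_1}` maps the
interval `I` (here `I = [a,b]`, lifted to `ℝ`; the integer `p` accounts for the
choice of lifts) into the `L`-neighborhood of `I` without intersecting `I`, then
this composition has a fixed point as a circle map. -/
theorem fixed_point_of_small_recurrence
    {l : ℕ} (ωs : Fin l → ℝ → ℝ) (hω : ∀ i, IsConcaveModulus (ωs i))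
    (gs : Fin l → ℝ → ℝ) (hg : ∀ i, IsCircleDiffeoLift (gs i))
    (C : ℝ) (hC : 0 ≤ C)
    (hconst : ∀ (i : Fin l) (x y : ℝ), |x - y| ≤ 1 →
      |Real.log (deriv (gs i) x) - Real.log (deriv (gs i) y)| ≤ C * ωs i |x - y|)
    (n₀ : ℕ) (k : ℕ → Fin l)
    (a b : ℝ) (hab : a < b) (hlen : b - a ≤ 1)
    (S : ℝ) (hS : 0 < S)
    (hsum : ∑ n ∈ Finset.range n₀,
        ωs (k n) (compSeq (fun i => gs (k i)) n b - compSeq (fun i => gs (k i)) n a) ≤ S)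
    (L : ℝ) (hL : L = (b - a) / (2 * Real.exp (2 * C * S)))
    (n : ℕ) (hn : n ≤ n₀) (p : ℤ)
    (hcont : Icc (compSeq (fun i => gs (k i)) n a + p) (compSeq (fun i => gs (k i)) n b + p)
        ⊆ Icc (a - L) (b + L))
    (hdisj : Disjoint
        (Icc (compSeq (fun i => gs (k i)) n a + p) (compSeq (fun i => gs (k i)) n b + p))
        (Icc a b)) :
    ∃ (x : ℝ) (m : ℤ), compSeq (fun i => gs (k i)) n x = x + m := by
  have hF := isCircleDiffeoLift_compSeq (fun i => hg (k i)) n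
  have key {u v : ℝ} (hu : u ≤ a) (hv : b ≤ v) (huv : v - u - (b - a) ≤ 2 * L) :=
    compSeq_sub_le_two_mul (fun i => hω (k i)) (fun i => hg (k i)) hC (fun i => hconst (k i))
      hab hlen hsum hu hv (huv.trans_eq (by rw [hL]; field_simp)) hn
  have hLpos : 0 < L := by
    rw [hL]
    exact div_pos (sub_pos.2 hab) (by positivity)
  set F := compSeq (fun i => gs (k i)) n
  have hFab : F a ≤ F b := hF.1.monotone hab.le
  have ha := hcont (left_mem_Icc.2 (by linarith))
  have hb := hcont (right_mem_Icc.2 (by linarith))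
  have hcts : Continuous fun x => F x + p - x := by
    have := hF.differentiable.continuous
    fun_prop
  suffices h : ∃ x, F x + p - x = 0 by
    obtain ⟨x, hx⟩ := h
    exact ⟨x, -p, by push_cast; linarith⟩
  have hsides : b < F a + p ∨ F b + p < a := by
    by_contra! h
    have hmem : max a (F a + p) ∈ Icc (F a + p) (F b + p) :=
      ⟨le_max_right _ _, max_le h.2 (by linarith)⟩
    exact Set.disjoint_left.1 hdisj hmem ⟨le_max_left _ _, max_le hab.le h.1⟩
  rcases hsides with h | h
  · have h2 := key le_rfl (by linarith : b ≤ b + 2 * L) (by linarith)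
    exact mem_range_of_exists_le_of_exists_ge hcts
      ⟨b + 2 * L, by linarith [hb.2]⟩ ⟨a, by linarith⟩
  · have h2 := key (by linarith : a - 2 * L ≤ a) le_rfl (by linarith)
    exact mem_range_of_exists_le_of_exists_ge hcts
      ⟨b, by linarith⟩ ⟨a - 2 * L, by linarith [ha.1]⟩
end

section
/- Let l_{i,j} be positive real numbers for i ∈ {1,…,m} and j ∈ {1,…,n} with Σ_{i=1}^m Σ_{j=1}^n l_{i,j} ≤ 1, and let ω : [0,1] → ℝ₊ be an increasing concave function. Then for any A > 0, the set of indices k ∈ {1,…,n} satisfying Σ_{i=1}^m ω(l_{i,k}) ≤ A·m·ω(1/(mn)) has cardinality at least (1 − 1/A)·n. -/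
open Set

/-- Jensen's inequality for a monotone concave function on `[0,1]`, applied to a finite family of
nonnegative reals with total at most `1`. -/
theorem sum_le_card_mul_of_monotoneOn_of_concaveOn {ι : Type*} [Fintype ι] [Nonempty ι]
    {ω : ℝ → ℝ} (hmono : MonotoneOn ω (Icc 0 1)) (hconc : ConcaveOn ℝ (Icc 0 1) ω)
    {x : ι → ℝ} (hx : ∀ i, 0 ≤ x i) (hsum : ∑ i, x i ≤ 1) :
    ∑ i, ω (x i) ≤ Fintype.card ι * ω (1 / Fintype.card ι) := by
  have hN : (1 : ℝ) ≤ Fintype.card ι := by exact_mod_cast Fintype.card_pos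
  set N : ℝ := (Fintype.card ι : ℝ)
  have hN0 : 0 < N := by linarith
  have hx1 (i : ι) : x i ≤ 1 :=
    (Finset.single_le_sum (fun j _ => hx j) (Finset.mem_univ i)).trans hsum
  have hjensen := hconc.le_map_sum (t := Finset.univ) (w := fun _ : ι => 1 / N) (p := x)
    (fun _ _ => by positivity) (by simp [N]) (fun i _ => ⟨hx i, hx1 i⟩)
  simp only [smul_eq_mul, ← Finset.mul_sum] at hjensen
  have hN1 : 1 / N ≤ 1 := (div_le_one hN0).2 hN
  have hmean : 1 / N * ∑ i, x i ≤ 1 / N := mul_le_of_le_one_right (by positivity) hsum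
  have hle := hjensen.trans (hmono
    ⟨mul_nonneg (by positivity) (Finset.sum_nonneg fun i _ => hx i), hmean.trans hN1⟩
    ⟨by positivity, hN1⟩ hmean)
  rwa [one_div_mul_eq_div, div_le_iff₀' hN0] at hle

/-- Markov's inequality for finite sums: if the average of `f ≥ 0` is at most `c`, then `f ≤ A * c`
on a proportion at least `1 - 1 / A` of the indices. -/
theorem le_card_filter_le_of_sum_le {κ : Type*} [Fintype κ] {f : κ → ℝ} {c A : ℝ}
    (hf : ∀ k, 0 ≤ f k) (hc : 0 ≤ c) (hA : 0 < A) (hsum : ∑ k, f k ≤ Fintype.card κ * c) :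
    (1 - 1 / A) * Fintype.card κ ≤ ((Finset.univ.filter fun k => f k ≤ A * c).card : ℝ) := by
  have hcard : ((Finset.univ.filter fun k => f k ≤ A * c).card : ℝ)
      + (Finset.univ.filter fun k => ¬ f k ≤ A * c).card = Fintype.card κ := by
    exact_mod_cast Finset.card_filter_add_card_filter_not (s := Finset.univ) fun k => f k ≤ A * c
  set B := Finset.univ.filter fun k => ¬ f k ≤ A * c with hB
  suffices h : (B.card : ℝ) ≤ Fintype.card κ / A by
    rw [sub_mul, one_div_mul_eq_div]
    linarith
  rcases hc.eq_or_lt with rfl | hc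
  · have hB0 : B = ∅ := by
      refine Finset.filter_false_of_mem fun k _ => not_not.2 ?_
      have := Finset.single_le_sum (fun j _ => hf j) (Finset.mem_univ k)
      linarith
    rw [hB0, Finset.card_empty, Nat.cast_zero]
    positivity
  · have hmarkov : B.card * (A * c) ≤ ∑ k, f k := by
      rw [← nsmul_eq_mul]
      refine (Finset.card_nsmul_le_sum B f _ fun k hk => ?_).trans
        (Finset.sum_le_univ_sum_of_nonneg hf)
      exact (not_le.1 (Finset.mem_filter.1 hk).2).le
    rw [le_div_iff₀ hA]
    exact le_of_mul_le_mul_right (by linarith) hc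

/-- Combinatorial lemma (quantitative version): if the positive numbers `l i j`
have total sum at most `1` and `ω : [0,1] → ℝ₊` is increasing and concave, then
for any `A > 0` the proportion of columns `k` with
`∑ i, ω (l i k) ≤ A · m · ω (1/(mn))` is at least `1 - 1/A`. -/
theorem many_columns_with_small_omega_sum
    (m n : ℕ) (hm : 1 ≤ m) (hn : 1 ≤ n)
    (l : Fin m → Fin n → ℝ) (hpos : ∀ i j, 0 < l i j)
    (hsum : ∑ i, ∑ j, l i j ≤ 1)
    (ω : ℝ → ℝ)
    (hmono : MonotoneOn ω (Icc 0 1))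
    (hconc : ConcaveOn ℝ (Icc 0 1) ω)
    (hpos' : ∀ t ∈ Icc (0 : ℝ) 1, 0 ≤ ω t)
    (A : ℝ) (hA : 0 < A) :
    (1 - 1 / A) * n ≤
      ((Finset.univ.filter
        (fun k : Fin n => ∑ i, ω (l i k) ≤ A * m * ω (1 / (m * n)))).card : ℝ) := by
  have : Nonempty (Fin m × Fin n) := ⟨⟨0, hm⟩, ⟨0, hn⟩⟩
  have hlsum : ∑ p : Fin m × Fin n, l p.1 p.2 ≤ 1 := by rwa [Fintype.sum_prod_type]
  have hl (i : Fin m) (k : Fin n) : l i k ∈ Icc (0 : ℝ) 1 :=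
    ⟨(hpos i k).le, (Finset.single_le_sum (f := fun p : Fin m × Fin n => l p.1 p.2)
      (fun p _ => (hpos p.1 p.2).le) (Finset.mem_univ (i, k))).trans hlsum⟩
  have htotal := sum_le_card_mul_of_monotoneOn_of_concaveOn hmono hconc
    (fun p : Fin m × Fin n => (hpos p.1 p.2).le) hlsum
  rw [Fintype.sum_prod_type_right, Fintype.card_prod, Fintype.card_fin, Fintype.card_fin,
    Nat.cast_mul] at htotal
  have hmn : (1 : ℝ) ≤ m * n := by exact_mod_cast Nat.mul_pos hm hn
  have hω : 0 ≤ ω (1 / (m * n)) :=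
    hpos' _ ⟨by positivity, (div_le_one (by linarith)).2 hmn⟩
  have hcard := le_card_filter_le_of_sum_le (f := fun k => ∑ i, ω (l i k))
    (c := m * ω (1 / (m * n))) (fun k => Finset.sum_nonneg fun i _ => hpos' _ (hl i k))
    (by positivity) hA (htotal.trans_eq (by rw [Fintype.card_fin]; ring))
  simpa only [Fintype.card_fin, mul_assoc] using hcard
end

section
/- Let d ≥ 2, let (R_m)_{m≥0} be an increasing sequence of d-dimensional integer rectangles R_m = [0,x_{1,m}] × ⋯ × [0,x_{d,m}] with R₀ = {(0,…,0)}, where for each k ∈ {1,…,d}, x_{k,m} = x_{k,m−1} if m ≢ k (mod d) and x_{k,m} > x_{k,m−1} if m ≡ k (mod d). For each m ≥ 1, let r(m) ∈ {1,…,d} with m ≡ r(m) (mod d), let 𝓛(m) be the set of all lines of integer points inside R_m in the r(m)-coordinate direction, and let 𝓛′(m) ⊆ 𝓛(m) satisfy |𝓛′(m)| ≥ (1 − 1/A_m)|𝓛(m)| for some A_m > 1. If M ∈ ℕ satisfies Σ_{m=1}^M 1/A_m < 1, then there exist lines L_m ∈ 𝓛′(m) for m = 1, …, M such that L_{m+1}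 intersects L_m for every 0 ≤ m < M, where L₀ denotes the origin. -/
open Set Finset

/-- The finite set of lines inside the integer rectangle `[0,x 0] × ⋯ × [0,x (d-1)]`
in the `r`-coordinate direction; a line is encoded by its base point (the point of
the line with `r`-coordinate `0`). -/
def rectLines {d : ℕ} (x : Fin d → ℕ) (r : Fin d) : Finset (Fin d → ℕ) :=
  (Fintype.piFinset fun j => Finset.range (x j + 1)).filter fun c => c r = 0

/-- The set of integer points of the line with base point `c` in the
`r`-coordinate direction inside the rectangle `[0,x 0] × ⋯ × [0,x (d-1)]`. -/
def linePoints {d : ℕ} (x : Fin d → ℕ) (r : Fin d) (c : Fin d → ℕ) : Set (Fin d → ℕ) :=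
  {p | (∀ j, j ≠ r → p j = c j) ∧ p r ≤ x r}

/-- The integer points of the rectangle `x` lying on a line of direction `r` with base in `S`. -/
def coveredPoints {d : ℕ} (x : Fin d → ℕ) (r : Fin d) (S : Finset (Fin d → ℕ)) :
    Finset (Fin d → ℕ) :=
  (Fintype.piFinset fun j => Finset.range (x j + 1)).filter fun p => Function.update p r 0 ∈ S

theorem mem_rectLines {d : ℕ} {x : Fin d → ℕ} {r : Fin d} {c : Fin d → ℕ} :
    c ∈ rectLines x r ↔ (∀ j, c j ≤ x j) ∧ c r = 0 := by
  simp [rectLines]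

theorem mem_coveredPoints {d : ℕ} {x : Fin d → ℕ} {r : Fin d} {S : Finset (Fin d → ℕ)}
    {p : Fin d → ℕ} :
    p ∈ coveredPoints x r S ↔ (∀ j, p j ≤ x j) ∧ Function.update p r 0 ∈ S := by
  simp [coveredPoints]

theorem update_zero_mem_rectLines {d : ℕ} {x : Fin d → ℕ} (r : Fin d) {p : Fin d → ℕ}
    (hp : ∀ j, p j ≤ x j) : Function.update p r 0 ∈ rectLines x r := by
  refine mem_rectLines.2 ⟨fun j => ?_, by simp⟩
  by_cases h : j = r
  · subst h; simp
  · simpa [h] using hp j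

theorem card_coveredPoints {d : ℕ} {x : Fin d → ℕ} {r : Fin d} {S : Finset (Fin d → ℕ)}
    (hS : S ⊆ rectLines x r) : (coveredPoints x r S).card = S.card * (x r + 1) := by
  rw [← Finset.card_range (x r + 1), ← Finset.card_product]
  refine Finset.card_nbij' (fun p => (Function.update p r 0, p r))
    (fun q => Function.update q.1 r q.2) ?_ ?_ ?_ ?_
  · intro p hp
    obtain ⟨h1, h2⟩ := mem_coveredPoints.1 hp
    simpa [Nat.lt_succ_iff] using And.intro h2 (h1 r)
  · rintro ⟨c, t⟩ hq
    obtain ⟨hc, ht⟩ := Finset.mem_product.1 hq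
    obtain ⟨h1, h2⟩ := mem_rectLines.1 (hS hc)
    refine mem_coveredPoints.2 ⟨fun j => ?_, ?_⟩
    · by_cases h : j = r
      · subst h; simpa [Nat.lt_succ_iff] using ht
      · simpa [h] using h1 j
    · have : Function.update c r 0 = c := by rw [← h2, Function.update_eq_self]
      simpa [this] using hc
  · intro p _
    simp
  · rintro ⟨c, t⟩ hq
    have h2 := (mem_rectLines.1 (hS (Finset.mem_product.1 hq).1)).2
    have : Function.update c r 0 = c := by rw [← h2, Function.update_eq_self]
    simp [this]

theorem coveredPoints_rectLines {d : ℕ} (x : Fin d → ℕ) (r : Fin d) :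
    coveredPoints x r (rectLines x r) = Fintype.piFinset fun j => Finset.range (x j + 1) := by
  refine Finset.filter_true_of_mem fun p hp => update_zero_mem_rectLines r fun j => ?_
  simpa [Nat.lt_succ_iff] using Fintype.mem_piFinset.1 hp j

theorem rectLines_congr {d : ℕ} {x y : Fin d → ℕ} {r : Fin d} (h : ∀ j, j ≠ r → y j = x j) :
    rectLines y r = rectLines x r := by
  ext c
  simp only [mem_rectLines]
  refine and_congr_left fun hc => forall_congr' fun j => ?_
  by_cases hj : j = r
  · subst hj; simp [hc]
  · rw [h j hj]

/-- The lines of direction `s` that meet a set of lines of direction `r` of density at least `σ`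
have density at least `σ`. -/
theorem mul_card_rectLines_le_card_image {d : ℕ} {x : Fin d → ℕ} {r : Fin d} (s : Fin d)
    {S : Finset (Fin d → ℕ)} (hS : S ⊆ rectLines x r) {σ : ℝ}
    (hσ : σ * ((rectLines x r).card : ℝ) ≤ S.card) :
    σ * ((rectLines x s).card : ℝ) ≤
      ((coveredPoints x r S).image fun p => Function.update p s 0).card := by
  set Q := (coveredPoints x r S).image fun p => Function.update p s 0
  have hQsub : Q ⊆ rectLines x s := by
    intro c hc
    obtain ⟨p, hp, rfl⟩ := Finset.mem_image.1 hc
    exact update_zero_mem_rectLines s (mem_coveredPoints.1 hp).1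
  have hsub : coveredPoints x r S ⊆ coveredPoints x s Q := fun p hp =>
    mem_coveredPoints.2 ⟨(mem_coveredPoints.1 hp).1, Finset.mem_image_of_mem _ hp⟩
  have hle : (S.card : ℝ) * (x r + 1) ≤ Q.card * (x s + 1) := by
    have := Finset.card_le_card hsub
    rw [card_coveredPoints hS, card_coveredPoints hQsub] at this
    exact_mod_cast this
  have heq : ((rectLines x r).card : ℝ) * (x r + 1) = (rectLines x s).card * (x s + 1) := by
    have h1 := card_coveredPoints (Finset.Subset.refl (rectLines x r))
    have h2 := card_coveredPoints (Finset.Subset.refl (rectLines x s))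
    rw [coveredPoints_rectLines] at h1 h2
    exact_mod_cast h1.symm.trans h2
  have hpos : (0 : ℝ) < x s + 1 := by positivity
  refine le_of_mul_le_mul_right ?_ hpos
  calc σ * ((rectLines x s).card : ℝ) * (x s + 1)
      = σ * ((rectLines x r).card : ℝ) * (x r + 1) := by rw [mul_assoc, ← heq, mul_assoc]
    _ ≤ S.card * (x r + 1) := by gcongr
    _ ≤ Q.card * (x s + 1) := hle

/-- Lemma (chains of admissible lines): in a nested sequence of integer rectangles
`R_m` growing in the cyclically-varying direction `r m`, given for each `m` a set
`𝓛' m` of lines in direction `r m` containing a proportion at least `1 - 1/A m` of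
all such lines, if `∑_{m=1}^M 1/A_m < 1` then one can choose lines `L_m ∈ 𝓛' m`,
`1 ≤ m ≤ M`, such that consecutive lines intersect and `L₁` passes through the
origin `L₀`. -/
theorem exists_chain_of_admissible_lines
    {d : ℕ} (hd : 2 ≤ d)
    (x : Fin d → ℕ → ℕ) (hx0 : ∀ k, x k 0 = 0)
    (r : ℕ → Fin d) (hr : ∀ m : ℕ, 1 ≤ m → (r m : ℕ) = (m - 1) % d)
    (hstay : ∀ (k : Fin d) (m : ℕ), 1 ≤ m → k ≠ r m → x k m = x k (m - 1))
    (hgrow : ∀ m : ℕ, 1 ≤ m → x (r m) (m - 1) < x (r m) m)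
    (A : ℕ → ℝ) (hA : ∀ m, 1 < A m)
    (L' : ℕ → Finset (Fin d → ℕ))
    (hL'sub : ∀ m, 1 ≤ m → L' m ⊆ rectLines (fun j => x j m) (r m))
    (hL'card : ∀ m, 1 ≤ m →
      (1 - 1 / A m) * ((rectLines (fun j => x j m) (r m)).card : ℝ) ≤ ((L' m).card : ℝ))
    (M : ℕ) (hM : ∑ m ∈ Finset.Icc 1 M, 1 / A m < 1) :
    ∃ c : ℕ → (Fin d → ℕ),
      (∀ m, 1 ≤ m → m ≤ M → c m ∈ L' m) ∧
      (1 ≤ M → (fun _ => 0) ∈ linePoints (fun j => x j 1) (r 1) (c 1)) ∧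
      ∀ m, 1 ≤ m → m < M →
        (linePoints (fun j => x j m) (r m) (c m) ∩
          linePoints (fun j => x j (m + 1)) (r (m + 1)) (c (m + 1))).Nonempty := by
  have key : ∀ m, 1 ≤ m → ∃ S ⊆ L' m,
      (1 - ∑ k ∈ Finset.Icc 1 m, 1 / A k) *
        ((rectLines (fun j => x j m) (r m)).card : ℝ) ≤ S.card ∧
      ∀ a ∈ S, ∃ c : ℕ → (Fin d → ℕ), c m = a ∧
        (∀ k, 1 ≤ k → k ≤ m → c k ∈ L' k) ∧
        (fun _ => 0) ∈ linePoints (fun j => x j 1) (r 1) (c 1) ∧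
        ∀ k, 1 ≤ k → k < m →
          (linePoints (fun j => x j k) (r k) (c k) ∩
            linePoints (fun j => x j (k + 1)) (r (k + 1)) (c (k + 1))).Nonempty := by
    intro m hm
    induction m, hm using Nat.le_induction with
    | base =>
      refine ⟨L' 1, Finset.Subset.refl _, by simpa using hL'card 1 le_rfl, fun a ha => ?_⟩
      refine ⟨fun _ => a, rfl, fun k h1 h2 => ?_, ⟨fun j hj => ?_, Nat.zero_le _⟩, ?_⟩
      · obtain rfl : k = 1 := le_antisymm h2 h1
        exact ha
      · have h := (mem_rectLines.1 (hL'sub 1 le_rfl ha)).1 j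
        simp only [hstay j 1 le_rfl hj, Nat.sub_self, hx0] at h
        exact (Nat.le_zero.1 h).symm
      · intro k h1 h2
        omega
    | succ m hm ih =>
      obtain ⟨S, hSL, hcard, hchain⟩ := ih
      have hS := hSL.trans (hL'sub m hm)
      have hcongr : rectLines (fun j => x j (m + 1)) (r (m + 1)) =
          rectLines (fun j => x j m) (r (m + 1)) :=
        rectLines_congr fun j hj => hstay j (m + 1) (by omega) hj
      have hQ := mul_card_rectLines_le_card_image (r (m + 1)) hS hcard
      set Q := (coveredPoints (fun j => x j m) (r m) S).image
        fun p => Function.update p (r (m + 1)) 0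
      have hQsub : Q ⊆ rectLines (fun j => x j (m + 1)) (r (m + 1)) := by
        rw [hcongr]
        intro c hc
        obtain ⟨p, hp, rfl⟩ := Finset.mem_image.1 hc
        exact update_zero_mem_rectLines _ (mem_coveredPoints.1 hp).1
      refine ⟨Q ∩ L' (m + 1), Finset.inter_subset_right, ?_, fun a ha => ?_⟩
      · have h1 : (Q.card : ℝ) + (L' (m + 1)).card ≤
            (rectLines (fun j => x j (m + 1)) (r (m + 1))).card + (Q ∩ L' (m + 1)).card := by
          have h := Finset.card_union_add_card_inter Q (L' (m + 1))
          have h' := Finset.card_le_card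
            (Finset.union_subset hQsub (hL'sub (m + 1) (by omega)))
          exact_mod_cast (by omega : Q.card + (L' (m + 1)).card ≤
            (rectLines (fun j => x j (m + 1)) (r (m + 1))).card + (Q ∩ L' (m + 1)).card)
        have h2 := hL'card (m + 1) (by omega)
        rw [← hcongr] at hQ
        rw [Finset.sum_Icc_succ_top (by omega)]
        linarith
      · obtain ⟨haQ, haL⟩ := Finset.mem_inter.1 ha
        obtain ⟨p, hp, rfl⟩ := Finset.mem_image.1 haQ
        obtain ⟨hpx, hpS⟩ := mem_coveredPoints.1 hp
        obtain ⟨c, hcm, hcL, hc0, hcc⟩ := hchain _ hpS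
        refine ⟨Function.update c (m + 1) (Function.update p (r (m + 1)) 0), by simp,
          fun k h1 h2 => ?_, ?_, fun k h1 h2 => ?_⟩
        · rcases Nat.lt_or_eq_of_le h2 with h | rfl
          · rw [Function.update_of_ne h.ne]
            exact hcL k h1 (by omega)
          · rwa [Function.update_self]
        · rwa [Function.update_of_ne (by omega)]
        · rw [Function.update_of_ne h2.ne]
          rcases Nat.lt_or_eq_of_le (Nat.lt_succ_iff.1 h2) with h | rfl
          · rw [Function.update_of_ne (by omega)]
            exact hcc k h1 h
          · rw [Function.update_self, hcm]
            refine ⟨p, ⟨fun j hj => by simp [hj], hpx _⟩, fun j hj => by simp [hj], ?_⟩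
            exact (hpx _).trans (hgrow (k + 1) (by omega)).le
  rcases Nat.eq_zero_or_pos M with rfl | hMpos
  · exact ⟨fun _ _ => 0, by intros; omega, by intros; omega, by intros; omega⟩
  · obtain ⟨S, -, hcard, hchain⟩ := key M hMpos
    have hpos : 0 < (rectLines (fun j => x j M) (r M)).card :=
      Finset.card_pos.2 ⟨fun _ => 0, mem_rectLines.2 ⟨fun _ => Nat.zero_le _, rfl⟩⟩
    have hS : (0 : ℝ) < S.card :=
      (mul_pos (sub_pos.2 hM) (Nat.cast_pos.2 hpos)).trans_le hcard
    obtain ⟨a, ha⟩ := Finset.card_pos.1 (Nat.cast_pos.1 hS)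
    obtain ⟨c, -, h1, h2, h3⟩ := hchain a ha
    exact ⟨c, h1, fun _ => h2, h3⟩
end

section
/- Let d ≥ 2 be an integer and let ω₁, …, ω_d be concave moduli of continuity with ω₁(t)·…·ω_d(t) = t·ω(t), where lim_{t→0⁺} ω(t) = 0 and ω(t₁t₂) ≤ C·ω(t₁)·ω(t₂) for some C > 0 and all t₁, t₂ ∈ [0,1]. Suppose that ω₁, …, ω_d together with all moduli of Hölder continuity form a comparable family. Then ω₁, …, ω_d satisfy the consistency condition: for every neighborhood U of the origin in [0,1]^d there exists (x₁,…,x_d) ∈ U with all x_k > 0 such that ω_k(x₁·…·x_d) ≤ C^{d−1}·ω₁(x_k)·…·ω_d(x_k) for every k ∈ {1,…,d}. -/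
open Filter Set

/-- The family consisting of the `ωs k` together with all moduli of Hölder continuity
`t ↦ t ^ a`, `a ∈ (0,1)`, is a comparable family of moduli of continuity. -/
def ComparableWithHolder {d : ℕ} (ωs : Fin d → ℝ → ℝ) : Prop :=
  ∃ δ > (0 : ℝ),
    (∀ i j : Fin d, (∀ x ∈ Ioo (0 : ℝ) δ, ωs i x ≤ ωs j x) ∨
      (∀ x ∈ Ioo (0 : ℝ) δ, ωs j x ≤ ωs i x)) ∧
    (∀ (i : Fin d), ∀ a ∈ Ioo (0 : ℝ) 1,
      (∀ x ∈ Ioo (0 : ℝ) δ, ωs i x ≤ x ^ a) ∨ (∀ x ∈ Ioo (0 : ℝ) δ, x ^ a ≤ ωs i x))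

lemma IsModulus.pos {w : ℝ → ℝ} (hw : IsModulus w) {t : ℝ} (ht : t ∈ Ioc (0 : ℝ) 1) :
    0 < w t := by
  have h := hw.2.1 (left_mem_Icc.2 zero_le_one) ⟨ht.1.le, ht.2⟩ ht.1
  rwa [hw.2.2.1] at h

lemma IsModulus.tendsto_zero {w : ℝ → ℝ} (hw : IsModulus w) :
    Tendsto w (nhdsWithin 0 (Ioi 0)) (nhds 0) := by
  have h := (hw.1 0 (left_mem_Icc.2 zero_le_one)).tendsto
  rw [hw.2.2.1] at h
  have hle : nhdsWithin (0 : ℝ) (Ioi 0) ≤ nhdsWithin 0 (Icc 0 1) := by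
    rw [← nhdsWithin_Ioc_eq_nhdsGT (zero_lt_one (α := ℝ))]
    exact nhdsWithin_mono _ Ioc_subset_Icc_self
  exact h.mono_left hle

lemma IsConcaveModulus.mul_le {w : ℝ → ℝ} (hw : IsConcaveModulus w) {t : ℝ}
    (ht : t ∈ Icc (0 : ℝ) 1) : w 1 * t ≤ w t := by
  have h := hw.2.2 (left_mem_Icc.2 zero_le_one) (right_mem_Icc.2 zero_le_one)
    (sub_nonneg.2 ht.2) ht.1 (by ring)
  simp only [hw.1.2.2.1, smul_eq_mul] at h
  ring_nf at h ⊢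
  linarith

/-- A concave modulus that is uniformly comparable with all Hölder moduli is squeezed
between a positive multiple of some power and that same power. -/
lemma IsConcaveModulus.exists_rpow_bounds {w : ℝ → ℝ} (hw : IsConcaveModulus w) {δ : ℝ}
    (hδ : 0 < δ) (hδ1 : δ ≤ 1)
    (hcomp : ∀ a ∈ Ioo (0 : ℝ) 1, (∀ x ∈ Ioo (0 : ℝ) δ, w x ≤ x ^ a) ∨
      (∀ x ∈ Ioo (0 : ℝ) δ, x ^ a ≤ w x)) :
    ∃ s m : ℝ, 0 < m ∧ ∀ x ∈ Ioo (0 : ℝ) δ, m * x ^ s ≤ w x ∧ w x ≤ x ^ s := by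
  set S : Set ℝ := insert 0 {a | a ∈ Ioo (0 : ℝ) 1 ∧ ∀ x ∈ Ioo (0 : ℝ) δ, w x ≤ x ^ a}
    with hS
  have hS1 : ∀ a ∈ S, a ≤ 1 := by
    rintro a (rfl | ha)
    · exact zero_le_one
    · exact ha.1.2.le
  have hbdd : BddAbove S := ⟨1, hS1⟩
  have hne : S.Nonempty := ⟨0, mem_insert _ _⟩
  set s := sSup S with hs
  have hs0 : 0 ≤ s := le_csSup hbdd (mem_insert _ _)
  have hs1 : s ≤ 1 := csSup_le hne hS1
  have hcont : ∀ x ∈ Ioo (0 : ℝ) δ, Continuous fun a : ℝ => x ^ a := fun x hx =>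
    Real.continuous_const_rpow hx.1.ne'
  have hlower : s < 1 → ∀ x ∈ Ioo (0 : ℝ) δ, x ^ s ≤ w x := by
    intro hlt x hx
    refine le_of_tendsto ((hcont x hx).tendsto s |>.mono_left
      (nhdsWithin_le_nhds (s := Ioi s))) ?_
    filter_upwards [Ioo_mem_nhdsGT hlt] with a ha
    have ha' : a ∈ Ioo (0 : ℝ) 1 := ⟨hs0.trans_lt ha.1, ha.2⟩
    rcases hcomp a ha' with h | h
    · exact absurd (le_csSup hbdd (mem_insert_of_mem _ ⟨ha', h⟩)) (not_le.2 ha.1)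
    · exact h x hx
  have hspos : 0 < s := by
    refine hs0.lt_of_ne fun h0 => ?_
    obtain ⟨x, hx1, hx2⟩ := ((hw.1.tendsto_zero.eventually_lt_const zero_lt_one).and
      (Ioo_mem_nhdsGT hδ)).exists
    have h := hlower (h0 ▸ zero_lt_one) x hx2
    rw [← h0, Real.rpow_zero] at h
    exact absurd h (not_le.2 hx1)
  have hupper : ∀ x ∈ Ioo (0 : ℝ) δ, w x ≤ x ^ s := by
    intro x hx
    refine ge_of_tendsto ((hcont x hx).tendsto s |>.mono_left
      (nhdsWithin_le_nhds (s := Iio s))) ?_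
    filter_upwards [Ioo_mem_nhdsLT hspos] with a ha
    obtain ⟨b, hb, hab⟩ := exists_lt_of_lt_csSup hne ha.2
    rcases hb with rfl | hb
    · exact absurd ha.1 (not_lt.2 hab.le)
    · exact (hb.2 x hx).trans
        (Real.rpow_le_rpow_of_exponent_ge hx.1 (hx.2.le.trans hδ1) hab.le)
  rcases hs1.lt_or_eq with hlt | heq
  · exact ⟨s, 1, one_pos, fun x hx => ⟨by simpa using hlower hlt x hx, hupper x hx⟩⟩
  · refine ⟨s, w 1, hw.1.pos ⟨one_pos, le_rfl⟩, fun x hx => ⟨?_, hupper x hx⟩⟩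
    rw [heq, Real.rpow_one]
    exact hw.mul_le ⟨hx.1.le, hx.2.le.trans hδ1⟩

lemma submultiplicative_prod_le {ι : Type*} {g : ℝ → ℝ} {C : ℝ} (hC : 0 ≤ C)
    (hg : ∀ t ∈ Icc (0 : ℝ) 1, 0 ≤ g t)
    (hsub : ∀ t₁ ∈ Icc (0 : ℝ) 1, ∀ t₂ ∈ Icc (0 : ℝ) 1, g (t₁ * t₂) ≤ C * g t₁ * g t₂)
    (x : ι → ℝ) (hx : ∀ i, x i ∈ Icc (0 : ℝ) 1) {s : Finset ι} (hs : s.Nonempty) :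
    C * g (∏ i ∈ s, x i) ≤ C ^ s.card * ∏ i ∈ s, g (x i) := by
  induction hs using Finset.Nonempty.cons_induction with
  | singleton a => simp
  | cons a s ha hs ih =>
    rw [Finset.prod_cons, Finset.prod_cons, Finset.card_cons, pow_succ]
    have hmem : ∏ i ∈ s, x i ∈ Icc (0 : ℝ) 1 :=
      ⟨Finset.prod_nonneg fun i _ => (hx i).1,
        Finset.prod_le_one (fun i _ => (hx i).1) fun i _ => (hx i).2⟩
    calc C * g (x a * ∏ i ∈ s, x i)
        ≤ C * (C * g (x a) * g (∏ i ∈ s, x i)) :=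
          mul_le_mul_of_nonneg_left (hsub _ (hx a) _ hmem) hC
      _ = C * g (x a) * (C * g (∏ i ∈ s, x i)) := by ring
      _ ≤ C * g (x a) * (C ^ s.card * ∏ i ∈ s, g (x i)) :=
          mul_le_mul_of_nonneg_left ih (mul_nonneg hC (hg _ (hx a)))
      _ = _ := by ring

/-- A function squeezed between a positive multiple of a power and that same power near `0`
cannot be submultiplicative with constant less than one. -/
lemma one_le_of_submultiplicative_of_rpow_bounds {g : ℝ → ℝ} {C δ s m : ℝ} (hC : 0 < C)
    (hδ : 0 < δ) (hδ1 : δ ≤ 1) (hm : 0 < m) (hg : ∀ t ∈ Icc (0 : ℝ) 1, 0 ≤ g t)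
    (hsub : ∀ t₁ ∈ Icc (0 : ℝ) 1, ∀ t₂ ∈ Icc (0 : ℝ) 1, g (t₁ * t₂) ≤ C * g t₁ * g t₂)
    (hb : ∀ x ∈ Ioo (0 : ℝ) δ, m * x ^ s ≤ g x ∧ g x ≤ x ^ s) : 1 ≤ C := by
  by_contra! hC1
  obtain ⟨n, hn⟩ := exists_pow_lt_of_lt_one hm hC1
  obtain ⟨t, ht0, htδ⟩ := exists_between hδ
  have ht : t ∈ Icc (0 : ℝ) 1 := ⟨ht0.le, htδ.le.trans hδ1⟩
  have h := submultiplicative_prod_le hC.le hg hsub (fun _ : Fin (n + 1) => t) (fun _ => ht)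
    Finset.univ_nonempty
  simp only [Finset.prod_const, Finset.card_univ, Fintype.card_fin] at h
  have hpow : t ^ (n + 1) ∈ Ioo (0 : ℝ) δ :=
    ⟨pow_pos ht0 _, (pow_le_of_le_one ht.1 ht.2 n.succ_ne_zero).trans_lt htδ⟩
  have hlow := (hb _ hpow).1
  have hup := pow_le_pow_left₀ (hg t ht) (hb t ⟨ht0, htδ⟩).2 (n + 1)
  have hcomm : (t ^ (n + 1)) ^ s = (t ^ s) ^ (n + 1) := Real.rpow_pow_comm ht0.le s (n + 1) |>.symm
  rw [hcomm] at hlow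
  have hpos : 0 < C * (t ^ s) ^ (n + 1) := by positivity
  have hle : m * (C * (t ^ s) ^ (n + 1)) ≤ C ^ n * (C * (t ^ s) ^ (n + 1)) :=
    calc m * (C * (t ^ s) ^ (n + 1)) = C * (m * (t ^ s) ^ (n + 1)) := by ring
      _ ≤ C * g (t ^ (n + 1)) := by gcongr
      _ ≤ C ^ (n + 1) * g t ^ (n + 1) := h
      _ ≤ C ^ (n + 1) * (t ^ s) ^ (n + 1) := by gcongr
      _ = _ := by ring
  exact absurd (le_of_mul_le_mul_right hle hpos) (not_le.2 hn)

/-- Under the hypotheses of the corollary (submultiplicative `ω` with `ω(0⁺) = 0`,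
and comparability with the Hölder moduli), the moduli `ω₁, …, ω_d` satisfy the
consistency condition: arbitrarily close to the origin there is `(x₁, …, x_d)`
with all `x_k > 0` and `ω_k(x₁⋯x_d) ≤ C^{d-1}·ω₁(x_k)⋯ω_d(x_k)` for every `k`. -/
theorem consistency_of_submultiplicative_and_comparable
    {d : ℕ} (hd : 2 ≤ d) (ωs : Fin d → ℝ → ℝ) (ω : ℝ → ℝ)
    (hmod : ∀ k, IsConcaveModulus (ωs k))
    (hprod : ∀ t ∈ Icc (0 : ℝ) 1, (∏ k, ωs k t) = t * ω t)
    (hlim : Tendsto ω (nhdsWithin 0 (Ioi 0)) (nhds 0))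
    (C : ℝ) (hC : 0 < C)
    (hsub : ∀ t₁ ∈ Icc (0 : ℝ) 1, ∀ t₂ ∈ Icc (0 : ℝ) 1, ω (t₁ * t₂) ≤ C * ω t₁ * ω t₂)
    (hcomp : ComparableWithHolder ωs)
    (ε : ℝ) (hε : 0 < ε) :
    ∃ x : Fin d → ℝ, (∀ k, 0 < x k ∧ x k < ε ∧ x k ≤ 1) ∧
      ∀ k : Fin d, ωs k (∏ j, x j) ≤ C ^ (d - 1) * ∏ j, ωs j (x k) := by
  have hne : (Finset.univ : Finset (Fin d)).Nonempty := ⟨⟨0, by omega⟩, Finset.mem_univ _⟩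
  set g : ℝ → ℝ := fun t => ∏ k, ωs k t with hg
  have hg_pos : ∀ t ∈ Ioc (0 : ℝ) 1, 0 < g t := fun t ht =>
    Finset.prod_pos fun k _ => (hmod k).1.pos ht
  have hg_nonneg : ∀ t ∈ Icc (0 : ℝ) 1, 0 ≤ g t := fun t ht =>
    Finset.prod_nonneg fun k _ => (hmod k).1.2.2.2 t ht
  have hg_cont : ContinuousOn g (Icc 0 1) :=
    continuousOn_finsetProd _ fun k _ => (hmod k).1.1
  have hg_zero : g 0 = 0 := by
    simpa using hprod 0 (left_mem_Icc.2 zero_le_one)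
  have hg_sub : ∀ t₁ ∈ Icc (0 : ℝ) 1, ∀ t₂ ∈ Icc (0 : ℝ) 1,
      g (t₁ * t₂) ≤ C * g t₁ * g t₂ := by
    intro t₁ h₁ t₂ h₂
    have h := mul_le_mul_of_nonneg_left (hsub t₁ h₁ t₂ h₂) (mul_nonneg h₁.1 h₂.1)
    simp only [hg]
    rw [hprod t₁ h₁, hprod t₂ h₂,
      hprod (t₁ * t₂) ⟨mul_nonneg h₁.1 h₂.1, mul_le_one₀ h₁.2 h₂.1 h₂.2⟩]
    linarith
  have hC1 : 1 ≤ C := by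
    obtain ⟨δ, hδ, -, hH⟩ := hcomp
    have hδ' : 0 < min δ 1 := lt_min hδ one_pos
    have hsubset : Ioo (0 : ℝ) (min δ 1) ⊆ Ioo 0 δ := Ioo_subset_Ioo_right (min_le_left _ _)
    choose s m hm hb using fun i => (hmod i).exists_rpow_bounds hδ' (min_le_right _ _)
      fun a ha => (hH i a ha).imp (fun h x hx => h x (hsubset hx))
        fun h x hx => h x (hsubset hx)
    refine one_le_of_submultiplicative_of_rpow_bounds (s := ∑ i, s i) (m := ∏ i, m i) hC hδ'
      (min_le_right _ _) (Finset.prod_pos fun i _ => hm i) hg_nonneg hg_sub fun x hx => ?_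
    rw [Real.rpow_sum_of_pos hx.1, ← Finset.prod_mul_distrib]
    exact ⟨Finset.prod_le_prod
        (fun i _ => mul_nonneg (hm i).le (Real.rpow_nonneg hx.1.le _)) fun i _ => (hb i x hx).1,
      Finset.prod_le_prod (fun i _ => (hmod i).1.2.2.2 x
        ⟨hx.1.le, hx.2.le.trans (min_le_right _ _)⟩) fun i _ => (hb i x hx).2⟩
  set A : ℝ := C ^ (d - 1) with hA
  have hA1 : 1 ≤ A := one_le_pow₀ hC1
  have hA0 : 0 < A := one_pos.trans_le hA1
  obtain ⟨η, hη0, hη⟩ := exists_between (lt_min hε (zero_lt_one (α := ℝ)))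
  have hη1 : η ≤ 1 := hη.le.trans (min_le_right _ _)
  have hgη : 0 < A * g η := mul_pos hA0 (hg_pos η ⟨hη0, hη1⟩)
  obtain ⟨t, htω, ht⟩ := ((eventually_all.2 fun k =>
    (hmod k).1.tendsto_zero.eventually_lt_const hgη).and
      (Ioc_mem_nhdsGT (zero_lt_one (α := ℝ)))).exists
  have hsolve : ∀ k, ∃ y ∈ Ioo (0 : ℝ) η, A * g y = ωs k t := fun k =>
    intermediate_value_Ioo hη0.le
      ((hg_cont.mono (Icc_subset_Icc_right hη1)).const_mul A)
      ⟨by simpa [hg_zero] using (hmod k).1.pos ht, htω k⟩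
  choose x hx hxt using hsolve
  have hx1 : ∀ k, x k ∈ Ioc (0 : ℝ) 1 := fun k => ⟨(hx k).1, (hx k).2.le.trans hη1⟩
  have hQ : ∏ k, x k ∈ Ioc (0 : ℝ) 1 :=
    ⟨Finset.prod_pos fun k _ => (hx1 k).1,
      Finset.prod_le_one (fun k _ => (hx1 k).1.le) fun k _ => (hx1 k).2⟩
  have hQt : ∏ k, x k ≤ t := by
    by_contra! hlt
    have hgt : g t < g (∏ k, x k) := Finset.prod_lt_prod_of_nonempty
      (fun k _ => (hmod k).1.pos ht)
      (fun k _ => (hmod k).1.2.1 ⟨ht.1.le, ht.2⟩ ⟨hQ.1.le, hQ.2⟩ hlt) hne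
    have hgt_eq : g t = A ^ d * ∏ k, g (x k) := by
      simp only [hg] at hxt ⊢
      simp [← hxt, Finset.prod_mul_distrib]
    have hle := submultiplicative_prod_le hC.le hg_nonneg hg_sub x
      (fun k => Ioc_subset_Icc_self (hx1 k)) hne
    have hCd : C ^ d = C * A := by
      rw [hA, ← pow_succ', Nat.sub_add_cancel (by omega)]
    rw [Finset.card_univ, Fintype.card_fin, hCd, mul_assoc] at hle
    have hAd : A ≤ A ^ d := le_self_pow₀ hA1 (by omega)
    have hAg := mul_le_mul_of_nonneg_right hAd
      (Finset.prod_nonneg fun k (_ : k ∈ Finset.univ) => (hg_pos _ (hx1 k)).le)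
    linarith [le_of_mul_le_mul_left hle hC]
  refine ⟨x, fun k => ⟨(hx k).1, (hx k).2.trans (hη.trans_le (min_le_left _ _)), (hx1 k).2⟩,
    fun k => ?_⟩
  calc ωs k (∏ j, x j) ≤ ωs k t :=
        (hmod k).1.2.1.monotoneOn ⟨hQ.1.le, hQ.2⟩ ⟨ht.1.le, ht.2⟩ hQt
    _ = A * g (x k) := (hxt k).symm
end
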